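/- For every c > 0 and every a > 0, one has ∫_ℝ Q_c(x − a)·Q'(x) dx < 0. -/

import Mathlib

/-- The soliton profile `Q(x) = ((p+1)/(2 cosh²(((p−1)/2)x)))^(1/(p−1))`. -/
noncomputable def Q (p : ℕ) (x : ℝ) : ℝ :=
  (((p : ℝ) + 1) / (2 * Real.cosh ((((p : ℝ) - 1) / 2) * x) ^ 2)) ^ (1 / ((p : ℝ) - 1))

/-- The rescaled soliton `Q_c(x) = c^(1/(p−1)) Q(√c x)`. -/
noncomputable def Qc (p : ℕ) (c : ℝ) (x : ℝ) : ℝ :=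
  c ^ (1 / ((p : ℝ) - 1)) * Q p (Real.sqrt c * x)

open MeasureTheory Filter Topology Set in
/-- The derivative of a differentiable nonnegative even function that is nonincreasing on the
positive half-line is integrable. -/
theorem integrable_deriv_of_even {g g' : ℝ → ℝ} (hg : ∀ x, HasDerivAt g (g' x) x)
    (g_nonneg : ∀ x, 0 ≤ g x) (g_anti : ∀ x y, |x| ≤ |y| → g y ≤ g x)
    (g'_odd : ∀ x, g' (-x) = -g' x) (g'_neg : ∀ x, 0 < x → g' x < 0) : Integrable g' := by
  have anti : Antitone fun x ↦ g (max x 0) := fun x y hxy ↦ g_anti _ _ <| by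
    rw [abs_of_nonneg (le_max_right _ _), abs_of_nonneg (le_max_right _ _)]
    exact max_le_max_right 0 hxy
  have lim := tendsto_atTop_ciInf anti ⟨0, by rintro _ ⟨x, rfl⟩; exact g_nonneg _⟩
  have lim' : Tendsto g atTop (𝓝 (⨅ x, g (max x 0))) := by
    refine lim.congr' ?_
    filter_upwards [eventually_ge_atTop 0] with x hx
    rw [max_eq_left hx]
  have int_pos : IntegrableOn g' (Ioi 0) :=
    integrableOn_Ioi_deriv_of_nonpos' (fun x _ ↦ hg x) (fun x hx ↦ (g'_neg x hx).le) lim'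
  have int_ind := (integrable_indicator_iff measurableSet_Ioi).2 int_pos
  refine (int_ind.sub int_ind.comp_neg).congr (Eventually.of_forall fun x ↦ ?_)
  have h0 : g' 0 = 0 := by have := g'_odd 0; rw [neg_zero] at this; linarith
  rcases lt_trichotomy x 0 with hx | rfl | hx
  · simp [hx, hx.le, g'_odd]
  · simp [h0]
  · simp [hx, hx.le]

open MeasureTheory Filter Set in
/-- The integral of an odd function that is negative on the positive half-line against a right
translate of an even function that decreases in `|x|` is negative. -/
theorem integral_translate_mul_neg_of_even {f g' : ℝ → ℝ} {a : ℝ} (ha : 0 < a)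
    (f_cont : Continuous f) (f_nonneg : ∀ x, 0 ≤ f x) (f_even : ∀ x, f (-x) = f x)
    (f_anti : ∀ x y, |x| < |y| → f y < f x)
    (g'_int : Integrable g') (g'_odd : ∀ x, g' (-x) = -g' x) (g'_neg : ∀ x, 0 < x → g' x < 0) :
    ∫ x, f (x - a) * g' x < 0 := by
  have f_le : ∀ x, f x ≤ f 0 := fun x ↦ by
    rcases eq_or_ne x 0 with rfl | hx
    · rfl
    · exact (f_anti 0 x (by simpa using hx)).le
  have int : Integrable fun x ↦ f (x - a) * g' x :=
    g'_int.bdd_mul (c := f 0) (by fun_prop)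
      (Eventually.of_forall fun x ↦ by
        rw [Real.norm_of_nonneg (f_nonneg _)]; exact f_le _)
  have sym : ∀ x, -(f (x - a) * g' x + f (-x - a) * g' (-x))
      = (f (x - a) - f (x + a)) * -g' x := fun x ↦ by
    rw [g'_odd, show -x - a = -(x + a) by ring, f_even]; ring
  have pos : ∀ x, 0 < x → 0 < -(f (x - a) * g' x + f (-x - a) * g' (-x)) := fun x hx ↦ by
    rw [sym]
    refine mul_pos (sub_pos.2 (f_anti _ _ ?_)) (neg_pos.2 (g'_neg x hx))
    rw [abs_of_pos (add_pos hx ha), abs_lt]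
    constructor <;> linarith
  have nonneg : ∀ x, 0 ≤ -(f (x - a) * g' x + f (-x - a) * g' (-x)) := fun x ↦ by
    rcases lt_trichotomy x 0 with hx | rfl | hx
    · have := pos (-x) (neg_pos.2 hx)
      rw [neg_neg] at this
      linarith
    · have := g'_odd 0
      rw [neg_zero] at this
      have h0 : g' 0 = 0 := by linarith
      simp [h0]
    · exact (pos x hx).le
  have int_sum := (int.add int.comp_neg).neg
  have key : 0 < ∫ x, -(f (x - a) * g' x + f (-x - a) * g' (-x)) := by
    refine (integral_pos_iff_support_of_nonneg nonneg int_sum).2 ?_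
    refine lt_of_lt_of_le ?_ (measure_mono (s := Ioi (0 : ℝ)) fun x hx ↦ (pos x hx).ne')
    simp
  rw [integral_neg, integral_add int int.comp_neg,
    integral_neg_eq_self (fun x ↦ f (x - a) * g' x)] at key
  linarith

theorem Q_pos {p : ℕ} (x : ℝ) : 0 < Q p x := by
  have := Real.cosh_pos (((p : ℝ) - 1) / 2 * x)
  unfold Q
  positivity

theorem Q_neg (p : ℕ) (x : ℝ) : Q p (-x) = Q p x := by
  simp [Q]

theorem Q_lt_Q {p : ℕ} (hp : 2 ≤ p) {x y : ℝ} (h : |x| < |y|) : Q p y < Q p x := by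
  have hp' : (2 : ℝ) ≤ p := by exact_mod_cast hp
  have hk : 0 < ((p : ℝ) - 1) / 2 := by linarith
  have hcosh : Real.cosh (((p : ℝ) - 1) / 2 * x) < Real.cosh (((p : ℝ) - 1) / 2 * y) := by
    rw [Real.cosh_lt_cosh, abs_mul, abs_mul]
    exact mul_lt_mul_of_pos_left h (abs_pos.2 hk.ne')
  have := Real.cosh_pos (((p : ℝ) - 1) / 2 * x)
  have := Real.cosh_pos (((p : ℝ) - 1) / 2 * y)
  unfold Q
  refine Real.rpow_lt_rpow (by positivity) (by gcongr) (one_div_pos.2 (by linarith))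

theorem Q_le_Q {p : ℕ} (hp : 2 ≤ p) {x y : ℝ} (h : |x| ≤ |y|) : Q p y ≤ Q p x := by
  rcases h.lt_or_eq with h | h
  · exact (Q_lt_Q hp h).le
  · rcases abs_eq_abs.1 h with rfl | rfl <;> simp [Q_neg]

theorem hasDerivAt_Q {p : ℕ} (hp : 2 ≤ p) (x : ℝ) :
    HasDerivAt (Q p) (-(Real.tanh (((p : ℝ) - 1) / 2 * x) * Q p x)) x := by
  have hp' : (2 : ℝ) ≤ p := by exact_mod_cast hp
  have hp1 : (p : ℝ) - 1 ≠ 0 := by linarith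
  have hcosh := Real.cosh_pos (((p : ℝ) - 1) / 2 * x)
  have hbase : 0 < ((p : ℝ) + 1) / (2 * Real.cosh (((p : ℝ) - 1) / 2 * x) ^ 2) := by positivity
  have hlin : HasDerivAt (fun y : ℝ ↦ ((p : ℝ) - 1) / 2 * y) (((p : ℝ) - 1) / 2) x := by
    simpa using (hasDerivAt_id x).const_mul (((p : ℝ) - 1) / 2)
  have hden : 2 * Real.cosh (((p : ℝ) - 1) / 2 * x) ^ 2 ≠ 0 := by positivity
  have h' := (((hasDerivAt_const x ((p : ℝ) + 1)).fun_div ((hlin.cosh.fun_pow 2).const_mul 2)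
    hden).rpow_const (p := 1 / ((p : ℝ) - 1)) (.inl hbase.ne'))
  refine h'.congr_deriv ?_
  rw [Real.rpow_sub_one hbase.ne', Real.tanh_eq_sinh_div_cosh]
  unfold Q
  field_simp
  ring

/-- For every `c > 0` and `a > 0`: `∫ Q_c(x − a) Q'(x) dx < 0`. -/
theorem stmt19 (p : ℕ) (hp : 2 ≤ p) (c : ℝ) (hc : 0 < c) (a : ℝ) (ha : 0 < a) :
    (∫ x : ℝ, Qc p c (x - a) * deriv (Q p) x) < 0 := by
  have hp' : (2 : ℝ) ≤ p := by exact_mod_cast hp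
  have hk : 0 < ((p : ℝ) - 1) / 2 := by linarith
  have hQ := hasDerivAt_Q hp
  have cont : Continuous (Q p) := continuous_iff_continuousAt.2 fun x ↦ (hQ x).continuousAt
  have odd : ∀ x, deriv (Q p) (-x) = -deriv (Q p) x := fun x ↦ by
    simp [(hQ _).deriv, Q_neg]
  have neg : ∀ x, 0 < x → deriv (Q p) x < 0 := fun x hx ↦ by
    rw [(hQ x).deriv, Real.tanh_eq_sinh_div_cosh]
    have := Real.sinh_pos_iff.2 (mul_pos hk hx)
    exact neg_neg_of_pos (mul_pos (div_pos this (Real.cosh_pos _)) (Q_pos x))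
  have hscale : 0 < c ^ (1 / ((p : ℝ) - 1)) := Real.rpow_pos_of_pos hc _
  refine integral_translate_mul_neg_of_even ha (f := Qc p c) ?_ ?_ ?_ ?_
    (integrable_deriv_of_even (fun x ↦ (hQ x).differentiableAt.hasDerivAt) (fun x ↦ (Q_pos x).le)
      (fun x y ↦ Q_le_Q hp) odd neg) odd neg
  · exact continuous_const.mul (cont.comp (continuous_const.mul continuous_id))
  · exact fun x ↦ (mul_pos hscale (Q_pos _)).le
  · intro x
    simp [Qc, Q_neg]
  · intro x y h
    refine mul_lt_mul_of_pos_left (Q_lt_Q hp ?_) hscale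
    rw [abs_mul, abs_mul]
    exact mul_lt_mul_of_pos_left h (abs_pos.2 (Real.sqrt_pos.2 hc).ne')
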